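/- The Dickman function integrates to e^γ over the half line: ∫₀^∞ ρ(x) dx = e^γ, where γ is the Euler–Mascheroni constant; equivalently, x ↦ e^{−γ} ρ(x) is a probability density on [0,∞). -/

import Mathlib

open Real MeasureTheory

open Set Filter Topology

/-- The continuous extension of `t ↦ (1 - exp (-t)) / t` to the real line. -/
noncomputable def expQuotient : ℝ → ℝ := dslope (fun t => 1 - exp (-t)) 0

theorem expQuotient_of_ne {t : ℝ} (ht : t ≠ 0) : expQuotient t = (1 - exp (-t)) / t := by
  simp [expQuotient, dslope_of_ne _ ht, slope_def_field]

theorem continuous_expQuotient : Continuous expQuotient := by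
  have hd : Differentiable ℝ (fun t : ℝ => 1 - exp (-t)) := by fun_prop
  refine continuous_iff_continuousAt.2 fun t => ?_
  by_cases ht : t = 0
  · subst ht
    exact continuousAt_dslope_same.2 hd.differentiableAt
  · exact (continuousAt_dslope_of_ne ht).2 hd.continuous.continuousAt

theorem hasDerivAt_integral_expQuotient (s : ℝ) :
    HasDerivAt (fun s => ∫ t in (0 : ℝ)..s, expQuotient t) (expQuotient s) s :=
  (continuous_expQuotient.integral_hasStrictDerivAt 0 s).hasDerivAt

/-- A function continuous on `[a, b]` with zero derivative inside takes equal values at the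
endpoints. -/
theorem eq_of_continuousOn_of_hasDerivAt_zero {f : ℝ → ℝ} {a b : ℝ} (hab : a < b)
    (hf : ContinuousOn f (Icc a b)) (hf' : ∀ x ∈ Ioo a b, HasDerivAt f 0 x) : f b = f a := by
  obtain ⟨c, -, hc⟩ := exists_hasDerivAt_eq_slope f (fun _ => 0) hab hf hf'
  have : b - a ≠ 0 := by linarith
  field_simp at hc
  linarith

theorem integral_log_mul_exp_neg :
    ∫ t in Ioi (0 : ℝ), log t * exp (-t) = -eulerMascheroniConstant := by
  have h1 := Complex.hasDerivAt_GammaIntegral (s := 1) (by simp)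
  have h2 : HasDerivAt Complex.GammaIntegral (-(eulerMascheroniConstant : ℂ)) 1 := by
    refine Complex.hasDerivAt_Gamma_one.congr_of_eventuallyEq ?_
    have : ∀ᶠ s : ℂ in 𝓝 1, 0 < s.re :=
      Complex.continuous_re.continuousAt.eventually (lt_mem_nhds (by simp))
    filter_upwards [this] with s hs
    exact (Complex.Gamma_eq_integral hs).symm
  have h3 := h1.unique h2
  simp only [sub_self, Complex.cpow_zero, one_mul] at h3
  have h4 : ∫ t in Ioi (0 : ℝ), ((log t * exp (-t) : ℝ) : ℂ)
      = ((-eulerMascheroniConstant : ℝ) : ℂ) := by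
    push_cast at h3 ⊢
    exact h3
  exact Complex.ofReal_injective (integral_complex_ofReal.symm.trans h4)

theorem integrableOn_log_mul_exp_neg :
    IntegrableOn (fun t => log t * exp (-t)) (Ioi (0 : ℝ)) := by
  by_contra h
  have h1 := integral_log_mul_exp_neg
  rw [integral_undef h] at h1
  linarith [one_half_lt_eulerMascheroniConstant]

theorem integral_expQuotient {s : ℝ} (hs : 0 < s) :
    ∫ t in (0 : ℝ)..s, expQuotient t
      = (1 - exp (-s)) * log s - ∫ t in (0 : ℝ)..s, log t * exp (-t) := by
  have hint : ∀ a b : ℝ, IntervalIntegrable (fun t => log t * exp (-t)) volume a b := fun a b =>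
    intervalIntegral.intervalIntegrable_log'.mul_continuousOn (by fun_prop)
  let D : ℝ → ℝ := fun s => (∫ t in (0 : ℝ)..s, expQuotient t)
      - expQuotient s * (s * log s) + ∫ t in (0 : ℝ)..s, log t * exp (-t)
  have hDcont : Continuous D :=
    ((intervalIntegral.continuous_primitive
      (fun a b => continuous_expQuotient.intervalIntegrable a b) 0).sub
      (continuous_expQuotient.mul continuous_mul_log)).add
      (intervalIntegral.continuous_primitive hint 0)
  have hD' : ∀ x ∈ Ioo 0 s, HasDerivAt D 0 x := by
    intro x hx
    have hx0 : x ≠ 0 := hx.1.ne'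
    have h1 : HasDerivAt (fun t => expQuotient t * (t * log t))
        (exp (-x) * log x + (1 - exp (-x)) * x⁻¹) x := by
      have h2 : HasDerivAt (fun t => 1 - exp (-t)) (exp (-x)) x := by
        simpa using ((hasDerivAt_id x).neg.exp).const_sub 1
      refine (h2.mul (hasDerivAt_log hx0)).congr_of_eventuallyEq ?_
      filter_upwards [lt_mem_nhds hx.1] with t ht
      rw [expQuotient_of_ne (ne_of_gt ht)]
      have : t ≠ 0 := ne_of_gt ht
      simp only [Pi.mul_apply]
      field_simp
    have h3 : HasDerivAt (fun s => ∫ t in (0 : ℝ)..s, log t * exp (-t)) (log x * exp (-x)) x := by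
      refine intervalIntegral.integral_hasDerivAt_right (hint 0 x) ?_ ?_
      · exact (measurable_log.mul
          (by fun_prop : Measurable fun t : ℝ =>
          exp (-t))).stronglyMeasurable.stronglyMeasurableAtFilter
      · exact (continuousAt_log hx0).mul (by fun_prop)
    refine (((hasDerivAt_integral_expQuotient x).sub h1).add h3).congr_deriv ?_
    rw [expQuotient_of_ne hx0]
    ring
  have h := eq_of_continuousOn_of_hasDerivAt_zero hs hDcont.continuousOn hD'
  simp only [D, intervalIntegral.integral_same, log_zero, mul_zero, sub_zero, add_zero,
    expQuotient_of_ne hs.ne'] at h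
  have h5 : (1 - exp (-s)) / s * (s * log s) = (1 - exp (-s)) * log s := by
    field_simp
  linarith

theorem tendsto_integral_expQuotient_sub_log :
    Tendsto (fun s => (∫ t in (0 : ℝ)..s, expQuotient t) - log s) atTop
      (𝓝 eulerMascheroniConstant) := by
  have h1 : Tendsto (fun s => exp (-s) * log s) atTop (𝓝 0) := by
    refine squeeze_zero_norm' ?_ (by simpa using tendsto_pow_mul_exp_neg_atTop_nhds_zero 1)
    filter_upwards [eventually_ge_atTop 1] with s hs
    rw [norm_mul, norm_of_nonneg (exp_pos _).le, norm_of_nonneg (log_nonneg hs), mul_comm]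
    gcongr
    linarith [log_le_sub_one_of_pos (by linarith : 0 < s)]
  have h2 := intervalIntegral_tendsto_integral_Ioi 0 integrableOn_log_mul_exp_neg tendsto_id
  rw [integral_log_mul_exp_neg] at h2
  have h3 := (h1.add h2).neg
  simp only [zero_add, neg_neg] at h3
  refine h3.congr' ?_
  filter_upwards [eventually_gt_atTop 0] with s hs
  rw [integral_expQuotient hs]
  simp only [id]
  ring

theorem dickman_mul_self_eq_integral {r : ℝ → ℝ} (hr : Continuous r) (hr1 : ∀ u ≤ 1, r u = 1)
    (hr' : ∀ u, 1 < u → HasDerivAt r (-r (u - 1) / u) u) {u : ℝ} (hu : 1 ≤ u) :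
    u * r u = ∫ t in (u - 1)..u, r t := by
  rcases hu.eq_or_lt with rfl | hu
  · rw [intervalIntegral.integral_congr (g := fun _ => 1)]
    · simp [hr1]
    · intro t ht
      simp at ht
      exact hr1 t ht.2
  let P : ℝ → ℝ := fun u => ∫ t in (0 : ℝ)..u, r t
  have hP : ∀ x, HasDerivAt P (r x) x := fun x => (hr.integral_hasStrictDerivAt 0 x).hasDerivAt
  have hPc : Continuous P := continuous_iff_continuousAt.2 fun x => (hP x).continuousAt
  have hsub : ∀ x, ∫ t in (x - 1)..x, r t = P x - P (x - 1) := fun x =>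
    (intervalIntegral.integral_interval_sub_left (hr.intervalIntegrable _ _)
      (hr.intervalIntegrable _ _)).symm
  have h := eq_of_continuousOn_of_hasDerivAt_zero (f := fun x => x * r x - (P x - P (x - 1))) hu
    (by fun_prop) ?_
  · have hP1 : P 1 = 1 := by
      simp only [P]
      rw [intervalIntegral.integral_congr (g := fun _ => 1)]
      · simp
      · intro t ht
        simp at ht
        exact hr1 t ht.2
    have hP0 : P 0 = 0 := by simp [P]
    simp only [sub_self, hP1, hP0, hr1 1 le_rfl] at h
    rw [hsub]
    linarith
  · intro x hx
    have h1 : HasDerivAt (fun x => P (x - 1)) (r (x - 1)) x := (hP (x - 1)).comp_sub_const x 1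
    refine (((hasDerivAt_id x).mul (hr' x hx.1)).sub ((hP x).sub h1)).congr_deriv ?_
    have : x ≠ 0 := by linarith [hx.1]
    simp only [id]
    field_simp
    ring

theorem exists_dickman_le_exp {r : ℝ → ℝ} (hr : Continuous r) (hr1 : ∀ u ≤ 1, r u = 1)
    (hr' : ∀ u, 1 < u → HasDerivAt r (-r (u - 1) / u) u) :
    ∃ C, ∀ u, 0 ≤ u → |r u| ≤ C * exp (-2 * u) := by
  have hcont : Continuous fun u => |r u| * exp (2 * u) := by fun_prop
  obtain ⟨c, -, hc⟩ := (isCompact_Icc (a := (0 : ℝ)) (b := 9)).exists_isMaxOn (by simp)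
    hcont.continuousOn
  refine ⟨|r c| * exp (2 * c), fun u hu => ?_⟩
  suffices h : |r u| * exp (2 * u) ≤ |r c| * exp (2 * c) by
    calc |r u| = |r u| * exp (2 * u) * exp (-2 * u) := by
          rw [mul_assoc, ← exp_add]; simp
      _ ≤ _ := by gcongr
  obtain ⟨v, hv, hvmax⟩ := (isCompact_Icc (a := (0 : ℝ)) (b := u)).exists_isMaxOn
    ⟨0, by simp [hu]⟩ hcont.continuousOn
  have huv := hvmax (right_mem_Icc.2 hu)
  simp only [mem_ofPred_eq] at huv
  refine huv.trans ?_
  by_cases hv9 : v ≤ 9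
  · exact hc ⟨hv.1, hv9⟩
  push Not at hv9
  set m := |r v| * exp (2 * v) with hm
  have hm0 : 0 ≤ m := by positivity
  have h1 : ‖∫ t in (v - 1)..v, r t‖ ≤ m * exp (-2 * (v - 1)) * |v - (v - 1)| := by
    refine intervalIntegral.norm_integral_le_of_norm_le_const fun t ht => ?_
    rw [uIoc_of_le (by linarith)] at ht
    have h2 : |r t| * exp (2 * t) ≤ m := hvmax ⟨by linarith [ht.1], by linarith [ht.2, hv.2]⟩
    calc ‖r t‖ = |r t| * exp (2 * t) * exp (-2 * t) := by
          rw [mul_assoc, ← exp_add]; simp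
      _ ≤ m * exp (-2 * (v - 1)) := by
          gcongr ?_ * ?_
          exact exp_le_exp.2 (by linarith [ht.1])
  rw [← dickman_mul_self_eq_integral hr hr1 hr' (by linarith), norm_mul,
    norm_of_nonneg (by linarith), norm_eq_abs, sub_sub_cancel, abs_one, mul_one] at h1
  have h3 : v * m ≤ m * exp 2 := by
    calc v * m = v * |r v| * exp (2 * v) := by rw [hm]; ring
      _ ≤ m * exp (-2 * (v - 1)) * exp (2 * v) := by gcongr
      _ = m * exp 2 := by rw [mul_assoc, ← exp_add]; ring_nf
  have he : exp 2 < 9 := by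
    have : exp 2 = exp 1 * exp 1 := by rw [← exp_add]; norm_num
    nlinarith [exp_one_lt_d9, exp_pos 1]
  have h4 : m ≤ 0 := by nlinarith
  exact h4.trans (by positivity)

theorem exists_dickman_le {r : ℝ → ℝ} (hr : Continuous r) (hr1 : ∀ u ≤ 1, r u = 1)
    (hr' : ∀ u, 1 < u → HasDerivAt r (-r (u - 1) / u) u) :
    ∃ K, 0 ≤ K ∧ ∀ u, 0 ≤ u → |r u| ≤ K := by
  obtain ⟨C, hC⟩ := exists_dickman_le_exp hr hr1 hr'
  have hC0 : 0 ≤ C := by simpa using (abs_nonneg _).trans (hC 0 le_rfl)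
  refine ⟨C, hC0, fun u hu => (hC u hu).trans ?_⟩
  exact mul_le_of_le_one_right hC0 (exp_le_one_iff.2 (by linarith))

theorem integrableOn_exp_mul_dickman {r : ℝ → ℝ} (hr : Continuous r) (hr1 : ∀ u ≤ 1, r u = 1)
    (hr' : ∀ u, 1 < u → HasDerivAt r (-r (u - 1) / u) u) {s : ℝ} (hs : -1 < s) :
    IntegrableOn (fun x => exp (-s * x) * r x) (Ioi 0) := by
  obtain ⟨C, hC⟩ := exists_dickman_le_exp hr hr1 hr'
  refine ((integrableOn_exp_mul_Ioi (a := -1) (by norm_num) 0).const_mul C).mono'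
    (by fun_prop) ?_
  filter_upwards [ae_restrict_mem measurableSet_Ioi] with x hx
  have hx : 0 < x := hx
  have hC0 : 0 ≤ C := by simpa using (abs_nonneg _).trans (hC 0 le_rfl)
  rw [norm_mul, norm_of_nonneg (exp_pos _).le, norm_eq_abs]
  calc exp (-s * x) * |r x| ≤ exp (-s * x) * (C * exp (-2 * x)) := by gcongr; exact hC x hx.le
    _ = C * exp (-s * x + -2 * x) := by rw [exp_add]; ring
    _ ≤ C * exp (-1 * x) := by
      gcongr
      nlinarith

theorem hasDerivAt_laplace_dickman {r : ℝ → ℝ} (hr : Continuous r) (hr1 : ∀ u ≤ 1, r u = 1)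
    (hr' : ∀ u, 1 < u → HasDerivAt r (-r (u - 1) / u) u) {s : ℝ} (hs : -1 < s) :
    IntegrableOn (fun x => exp (-s * x) * (-x) * r x) (Ioi 0) ∧
    HasDerivAt (fun s => ∫ x in Ioi 0, exp (-s * x) * r x)
      (∫ x in Ioi 0, exp (-s * x) * (-x) * r x) s := by
  obtain ⟨C, hC⟩ := exists_dickman_le_exp hr hr1 hr'
  have hC0 : 0 ≤ C := by simpa using (abs_nonneg _).trans (hC 0 le_rfl)
  refine hasDerivAt_integral_of_dominated_loc_of_deriv_le
    (F := fun s x => exp (-s * x) * r x) (F' := fun s x => exp (-s * x) * (-x) * r x)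
    (bound := fun x => C * (x ^ (1 : ℝ) * exp (-1 * x ^ (1 : ℝ))))
    (Ioi_mem_nhds hs) (Eventually.of_forall fun s => by fun_prop)
    (integrableOn_exp_mul_dickman hr hr1 hr' hs) (by fun_prop) ?_
    ((integrableOn_rpow_mul_exp_neg_mul_rpow (by norm_num) (by norm_num)
      (by norm_num)).const_mul C) ?_
  · filter_upwards [ae_restrict_mem measurableSet_Ioi] with x hx t ht
    have hx : 0 < x := hx
    have ht : -1 < t := ht
    rw [norm_mul, norm_mul, norm_of_nonneg (exp_pos _).le, norm_neg, norm_of_nonneg hx.le,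
      norm_eq_abs, rpow_one]
    calc exp (-t * x) * x * |r x| ≤ exp (-t * x) * x * (C * exp (-2 * x)) := by
          gcongr; exact hC x hx.le
      _ = C * (x * exp (-t * x + -2 * x)) := by rw [exp_add]; ring
      _ ≤ C * (x * exp (-1 * x)) := by
        gcongr
        nlinarith
  · filter_upwards with x t _
    refine HasDerivAt.mul_const ?_ (r x)
    exact ((hasDerivAt_id t).neg.mul_const x).exp.congr_deriv (by simp)

theorem laplace_dickman_delay {r : ℝ → ℝ} (hr : Continuous r) (hr1 : ∀ u ≤ 1, r u = 1)
    (hr' : ∀ u, 1 < u → HasDerivAt r (-r (u - 1) / u) u) {s : ℝ} (hs : 0 < s) :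
    s * ∫ x in Ioi 0, exp (-s * x) * (-x) * r x
      = -((1 - exp (-s)) * ∫ x in Ioi 0, exp (-s * x) * r x) := by
  have hi1 := integrableOn_exp_mul_dickman hr hr1 hr' (by linarith : -1 < s)
  have hi2 := (hasDerivAt_laplace_dickman hr hr1 hr' (by linarith : -1 < s)).1
  have hsub : Ioi (1 : ℝ) ⊆ Ioi 0 := Ioi_subset_Ioi zero_le_one
  have hpre : (fun x : ℝ => x - 1) ⁻¹' Ioi 0 = Ioi 1 := by ext; simp
  have hshift : ∀ x : ℝ, exp (-s) * (exp (-s * (x - 1)) * r (x - 1))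
      = exp (-s * x) * r (x - 1) := fun x => by
    rw [← mul_assoc, ← exp_add]; ring_nf
  have hi3 : IntegrableOn (fun x => exp (-s * x) * r (x - 1)) (Ioi 1) := by
    have := ((measurePreserving_sub_right volume (1 : ℝ)).integrableOn_comp_preimage
      (measurableEmbedding_subRight 1)).2 hi1
    rw [hpre] at this
    refine (this.const_mul (exp (-s))).congr (Eventually.of_forall fun x => ?_)
    exact hshift x
  have h3 : ∫ x in Ioi 1, exp (-s * x) * r (x - 1)
      = exp (-s) * ∫ x in Ioi 0, exp (-s * x) * r x := by
    have := (measurePreserving_sub_right volume (1 : ℝ)).setIntegral_preimage_emb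
      (measurableEmbedding_subRight 1) (fun x => exp (-s * x) * r x) (Ioi 0)
    rw [← this, hpre, ← integral_const_mul]
    simp only [hshift]
  let g : ℝ → ℝ := fun x => s * (exp (-s * x) * (-x) * r x) + exp (-s * x) * r x
  have hg : IntegrableOn g (Ioi 0) := (hi2.const_mul s).add hi1
  have hexp : ∀ x, HasDerivAt (fun x => exp (-s * x) * x)
      (exp (-s * x) - s * (exp (-s * x) * x)) x := by
    intro x
    have h := (((hasDerivAt_id x).const_mul (-s)).exp).mul (hasDerivAt_id x)
    refine h.congr_deriv ?_
    simp only [id]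
    ring
  have hg1 : ∫ x in (0 : ℝ)..1, g x = exp (-s) := by
    rw [intervalIntegral.integral_congr (g := fun x => exp (-s * x) - s * (exp (-s * x) * x)),
      intervalIntegral.integral_eq_sub_of_hasDerivAt (fun x _ => hexp x)
        (Continuous.intervalIntegrable (by fun_prop) _ _)]
    · simp
    · intro x hx
      simp at hx
      simp only [g, hr1 x hx.2]
      ring
  have hg2 : ∫ x in Ioi 1, (g x - exp (-s * x) * r (x - 1)) = 0 - exp (-s * 1) * 1 * r 1 := by
    refine integral_Ioi_of_hasDerivAt_of_tendsto (f := fun x => exp (-s * x) * x * r x)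
      (by fun_prop) ?_ ((hg.mono_set hsub).sub hi3) ?_
    · intro x hx
      have hx : 1 < x := hx
      refine ((hexp x).mul (hr' x hx)).congr_deriv ?_
      have : x ≠ 0 := by linarith
      simp only [g]
      field_simp
      ring
    · obtain ⟨K, hK0, hK⟩ := exists_dickman_le hr hr1 hr'
      have h0 : Tendsto (fun x => K / s * ((s * x) ^ 1 * exp (-(s * x)))) atTop (𝓝 0) := by
        simpa using ((tendsto_pow_mul_exp_neg_atTop_nhds_zero 1).comp
          (tendsto_id.const_mul_atTop hs)).const_mul (K / s)
      refine squeeze_zero_norm' ?_ h0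
      filter_upwards [eventually_ge_atTop 0] with x hx
      rw [norm_mul, norm_of_nonneg (by positivity), norm_eq_abs]
      calc exp (-s * x) * x * |r x| ≤ exp (-s * x) * x * K := by gcongr; exact hK x hx
        _ = _ := by
          rw [neg_mul]
          field_simp
  rw [integral_sub (hg.mono_set hsub) hi3, h3, hr1 1 le_rfl] at hg2
  have hsplit : ∫ x in Ioi 0, g x = (∫ x in (0 : ℝ)..1, g x) + ∫ x in Ioi 1, g x := by
    rw [intervalIntegral.integral_of_le zero_le_one, ← setIntegral_union
      (Ioc_disjoint_Ioi le_rfl) measurableSet_Ioi (hg.mono_set Ioc_subset_Ioi_self)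
      (hg.mono_set hsub), Ioc_union_Ioi_eq_Ioi zero_le_one]
  have hsum : ∫ x in Ioi 0, g x = s * (∫ x in Ioi 0, exp (-s * x) * (-x) * r x)
      + ∫ x in Ioi 0, exp (-s * x) * r x := by
    rw [← integral_const_mul, ← integral_add (hi2.const_mul s) hi1]
  simp only [mul_one] at hg2
  linarith

theorem laplace_dickman_mul_exp {r : ℝ → ℝ} (hr : Continuous r) (hr1 : ∀ u ≤ 1, r u = 1)
    (hr' : ∀ u, 1 < u → HasDerivAt r (-r (u - 1) / u) u) {s : ℝ} (hs : 0 < s) :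
    (∫ x in Ioi 0, exp (-s * x) * r x) * exp (∫ t in (0 : ℝ)..s, expQuotient t)
      = ∫ x in Ioi 0, r x := by
  have hM : ∀ x, -1 < x → HasDerivAt (fun s => (∫ x in Ioi 0, exp (-s * x) * r x)
      * exp (∫ t in (0 : ℝ)..s, expQuotient t)) _ x := fun x hx =>
    (hasDerivAt_laplace_dickman hr hr1 hr' hx).2.mul (hasDerivAt_integral_expQuotient x).exp
  have h := eq_of_continuousOn_of_hasDerivAt_zero hs
    (fun x hx => (hM x (by linarith [hx.1])).continuousAt.continuousWithinAt) ?_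
  · simpa using h
  · intro x hx
    have hx0 : x ≠ 0 := hx.1.ne'
    refine (hM x (by linarith [hx.1])).congr_deriv ?_
    have h1 := laplace_dickman_delay hr hr1 hr' hx.1
    rw [expQuotient_of_ne hx0]
    set A := ∫ y in Ioi 0, exp (-x * y) * (-y) * r y
    set B := ∫ y in Ioi 0, exp (-x * y) * r y
    field_simp
    linear_combination exp (∫ t in (0 : ℝ)..x, expQuotient t) * h1

theorem tendsto_mul_laplace_dickman {r : ℝ → ℝ} (hr : Continuous r) (hr1 : ∀ u ≤ 1, r u = 1)
    (hr' : ∀ u, 1 < u → HasDerivAt r (-r (u - 1) / u) u) :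
    Tendsto (fun s => s * ∫ x in Ioi 0, exp (-s * x) * r x) atTop (𝓝 1) := by
  obtain ⟨K, hK0, hK⟩ := exists_dickman_le hr hr1 hr'
  have h1 : Tendsto (fun s : ℝ => ∫ y in Ioi (0 : ℝ), exp (-y) * r (s⁻¹ * y)) atTop
      (𝓝 (∫ y in Ioi (0 : ℝ), exp (-y) * r (0 * y))) := by
    refine tendsto_integral_filter_of_dominated_convergence (fun y => K * exp (-1 * y))
      (Eventually.of_forall fun s => by fun_prop) ?_
      ((integrableOn_exp_mul_Ioi (by norm_num) 0).const_mul K) ?_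
    · filter_upwards [eventually_gt_atTop 0] with s hs
      filter_upwards [ae_restrict_mem measurableSet_Ioi] with y hy
      have hy : 0 < y := hy
      rw [norm_mul, norm_of_nonneg (exp_pos _).le, norm_eq_abs, neg_one_mul, mul_comm]
      gcongr
      exact hK _ (by positivity)
    · filter_upwards with y
      exact ((hr.tendsto _).comp (tendsto_inv_atTop_zero.mul_const y)).const_mul _
  have h2 : ∫ y in Ioi (0 : ℝ), exp (-y) * r (0 * y) = 1 := by
    simp only [zero_mul, hr1 0 zero_le_one, mul_one, integral_exp_neg_Ioi, neg_zero, exp_zero]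
  rw [h2] at h1
  refine h1.congr' ?_
  filter_upwards [eventually_gt_atTop 0] with s hs
  have h3 := integral_comp_mul_left_Ioi (fun y => exp (-y) * r (s⁻¹ * y)) 0 hs
  have hs0 : s ≠ 0 := hs.ne'
  simp only [mul_zero, smul_eq_mul, inv_mul_cancel_left₀ hs0, ← neg_mul] at h3
  rw [h3, mul_inv_cancel_left₀ hs0]

theorem integral_dickman {r : ℝ → ℝ} (hr : Continuous r) (hr1 : ∀ u ≤ 1, r u = 1)
    (hr' : ∀ u, 1 < u → HasDerivAt r (-r (u - 1) / u) u) :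
    ∫ x in Ioi 0, r x = exp eulerMascheroniConstant := by
  have h := (tendsto_mul_laplace_dickman hr hr1 hr').mul
    ((continuous_exp.tendsto _).comp tendsto_integral_expQuotient_sub_log)
  rw [one_mul] at h
  refine tendsto_nhds_unique (tendsto_const_nhds.congr' ?_) h
  filter_upwards [eventually_gt_atTop 0] with s hs
  rw [← laplace_dickman_mul_exp hr hr1 hr' hs, Function.comp_apply, exp_sub, exp_log hs]
  field_simp

/-- The Dickman function integrates to `e^γ` over the half line: if `ρ` is the unique
continuous solution of `u ρ'(u) = −ρ(u−1)` for `u > 1` with `ρ ≡ 1` on `[0,1]`, then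
`∫₀^∞ ρ(x) dx = e^γ`. -/
theorem dickman_integral_eq_exp_gamma
    (ρ : ℝ → ℝ)
    (hρ_cont : ContinuousOn ρ (Set.Ici (0 : ℝ)))
    (hρ_init : ∀ u : ℝ, 0 ≤ u → u ≤ 1 → ρ u = 1)
    (hρ_delay : ∀ u : ℝ, 1 < u → HasDerivAt ρ (-ρ (u - 1) / u) u) :
    ∫ x in Set.Ioi (0 : ℝ), ρ x = Real.exp Real.eulerMascheroniConstant := by
  have hr : Continuous fun u => ρ (max u 0) :=
    hρ_cont.comp_continuous (by fun_prop) fun u => le_max_right u 0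
  rw [← integral_dickman hr (fun u hu => hρ_init _ (le_max_right _ _) (by simp [hu])) ?_]
  · refine setIntegral_congr_fun measurableSet_Ioi fun x hx => ?_
    rw [max_eq_left (mem_Ioi.1 hx).le]
  · intro u hu
    rw [max_eq_left (by linarith)]
    refine (hρ_delay u hu).congr_of_eventuallyEq ?_
    filter_upwards [lt_mem_nhds (zero_lt_one.trans hu)] with x hx
    rw [max_eq_left hx.le]
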